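/- Let n ≥ 2, let D be a torsion-free affine connection on ℝⁿ and let g be its Patterson–Walker metric on ℝ^{2n}. Then the Laplacian of g annihilates every horizontal function: for every smooth function f : ℝⁿ → ℝ, the function F(x,p) = f(x) on ℝ^{2n} satisfies Δ_g F = 0 identically, where Δ_g F = ∑_{i,j} (g^{-1})^{ij} (∂_i ∂_j F − ∑_k Γ̃^k_{ij} ∂_k F) and Γ̃ are the Levi-Civita Christoffel symbols of g. -/

import Mathlib

open scoped BigOperators

/-- Partial derivative of a function on `ι → ℝ` in coordinate direction `i`. -/
noncomputable def pd {ι : Type} [Fintype ι] [DecidableEq ι] (i : ι)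
    (f : (ι → ℝ) → ℝ) (x : ι → ℝ) : ℝ :=
  fderiv ℝ f x (Pi.single i 1)

/-- Ricci curvature of an affine connection given by coefficients `Γ k i j`. -/
noncomputable def ricConn {ι : Type} [Fintype ι] [DecidableEq ι]
    (Γ : ι → ι → ι → (ι → ℝ) → ℝ) (i j : ι) (x : ι → ℝ) : ℝ :=
  (∑ k, pd k (fun y => Γ k i j y) x) - (∑ k, pd i (fun y => Γ k k j y) x)
    + ∑ k, ∑ l, (Γ k k l x * Γ l i j x - Γ k i l x * Γ l k j x)

/-- Levi-Civita Christoffel symbols of a metric in coordinates. -/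
noncomputable def christoffel {ι : Type} [Fintype ι] [DecidableEq ι]
    (G : (ι → ℝ) → Matrix ι ι ℝ) (k i j : ι) (x : ι → ℝ) : ℝ :=
  (1/2) * ∑ l, (G x)⁻¹ k l *
    (pd i (fun y => G y j l) x + pd j (fun y => G y i l) x - pd l (fun y => G y i j) x)

/-- Laplacian of a metric in coordinates, applied to a function. -/
noncomputable def laplacian {ι : Type} [Fintype ι] [DecidableEq ι]
    (G : (ι → ℝ) → Matrix ι ι ℝ) (F : (ι → ℝ) → ℝ) (x : ι → ℝ) : ℝ :=
  ∑ i, ∑ j, (G x)⁻¹ i j *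
    (pd i (fun y => pd j F y) x - ∑ k, christoffel G k i j x * pd k F x)

/-- Lie derivative of a metric along a vector field, in coordinates. -/
noncomputable def lieDeriv {ι : Type} [Fintype ι] [DecidableEq ι]
    (X : ι → (ι → ℝ) → ℝ) (G : (ι → ℝ) → Matrix ι ι ℝ) (i j : ι) (x : ι → ℝ) : ℝ :=
  (∑ k, X k x * pd k (fun y => G y i j) x)
  + (∑ k, pd i (X k) x * G x k j) + ∑ k, pd j (X k) x * G x i k

/-- Index type for the ambient space: `t`, `x^A`, `p_A`, `ρ`. -/
abbrev AmbIdx (n : ℕ) : Type := Unit ⊕ (Fin n ⊕ (Fin n ⊕ Unit))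

def it (n : ℕ) : AmbIdx n := Sum.inl ()
def ix {n : ℕ} (A : Fin n) : AmbIdx n := Sum.inr (Sum.inl A)
def ip {n : ℕ} (A : Fin n) : AmbIdx n := Sum.inr (Sum.inr (Sum.inl A))
def irho (n : ℕ) : AmbIdx n := Sum.inr (Sum.inr (Sum.inr ()))

/-- The `x`-coordinates of an ambient point. -/
def xc {n : ℕ} (u : AmbIdx n → ℝ) : Fin n → ℝ := fun A => u (ix A)

/-- The ambient metric of the affine connection `Γ`. -/
noncomputable def ambientMetric (n : ℕ) (Γ : Fin n → Fin n → Fin n → (Fin n → ℝ) → ℝ)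
    (u : AmbIdx n → ℝ) : Matrix (AmbIdx n) (AmbIdx n) ℝ :=
  Matrix.of fun a b =>
    match a, b with
    | Sum.inl _, Sum.inl _ => 2 * u (irho n)
    | Sum.inl _, Sum.inr (Sum.inr (Sum.inr _)) => u (it n)
    | Sum.inr (Sum.inr (Sum.inr _)), Sum.inl _ => u (it n)
    | Sum.inr (Sum.inl A), Sum.inr (Sum.inr (Sum.inl B)) =>
        (u (it n))^2 * (if A = B then (1:ℝ) else 0)
    | Sum.inr (Sum.inr (Sum.inl A)), Sum.inr (Sum.inl B) =>
        (u (it n))^2 * (if A = B then (1:ℝ) else 0)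
    | Sum.inr (Sum.inl A), Sum.inr (Sum.inl B) =>
        (u (it n))^2 * (-2 * ∑ C, u (ip C) * Γ C A B (xc u)
          + (2 * u (irho n) / ((n:ℝ) - 1)) * ricConn Γ A B (xc u))
    | _, _ => 0

/-- The Patterson–Walker metric of a torsion-free affine connection with
coefficients `Γ`, on the doubled space with coordinates `(x, y)`. -/
noncomputable def pwGen {ι : Type} [Fintype ι] [DecidableEq ι]
    (Γ : ι → ι → ι → (ι → ℝ) → ℝ) (u : (ι ⊕ ι) → ℝ) : Matrix (ι ⊕ ι) (ι ⊕ ι) ℝ :=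
  Matrix.of fun a b =>
    match a, b with
    | Sum.inl i, Sum.inl j => -2 * ∑ k, u (Sum.inr k) * Γ k i j (fun l => u (Sum.inl l))
    | Sum.inl i, Sum.inr j => if i = j then (1:ℝ) else 0
    | Sum.inr i, Sum.inl j => if i = j then (1:ℝ) else 0
    | Sum.inr _, Sum.inr _ => 0

/-- `D` preserves a volume form: there is a smooth positive `v` with
`∑_C Γ^C_{AC} = ∂_A (log v)`. -/
def PreservesVolume (n : ℕ) (Γ : Fin n → Fin n → Fin n → (Fin n → ℝ) → ℝ) : Prop :=
  ∃ v : (Fin n → ℝ) → ℝ, ContDiff ℝ (⊤ : ℕ∞) v ∧ (∀ x, 0 < v x) ∧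
    ∀ (A : Fin n) (x : Fin n → ℝ), (∑ C, Γ C A C x) = pd A (fun y => Real.log (v y)) x

/-- Index type for the Thomas cone: `x^0` and `x^A`. -/
abbrev ThIdx (n : ℕ) : Type := Unit ⊕ Fin n

/-- The Thomas cone connection of the affine connection `Γ`. -/
noncomputable def thomasConn (n : ℕ) (Γ : Fin n → Fin n → Fin n → (Fin n → ℝ) → ℝ) :
    ThIdx n → ThIdx n → ThIdx n → ((ThIdx n) → ℝ) → ℝ := fun c a b u =>
  match c, a, b with
  | Sum.inr C, Sum.inr A, Sum.inr B => Γ C A B (fun E => u (Sum.inr E))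
  | Sum.inl _, Sum.inr A, Sum.inr B =>
      -(u (Sum.inl ()) / ((n:ℝ) - 1)) * ricConn Γ A B (fun E => u (Sum.inr E))
  | Sum.inr B, Sum.inr A, Sum.inl _ => if A = B then 1 / u (Sum.inl ()) else 0
  | Sum.inr B, Sum.inl _, Sum.inr A => if A = B then 1 / u (Sum.inl ()) else 0
  | _, _, _ => 0

/-- A function invariant under translations along the `i`-th axis has zero `i`-th partial
derivative. -/
theorem pd_eq_zero_of_invariant {ι : Type} [Fintype ι] [DecidableEq ι] {i : ι}
    {g : (ι → ℝ) → ℝ} (hg : ∀ w (t : ℝ), g (w + t • Pi.single i 1) = g w) (x : ι → ℝ) :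
    pd i g x = 0 := by
  unfold pd
  by_cases h : DifferentiableAt ℝ g x
  · rw [← h.lineDeriv_eq_fderiv, lineDeriv]
    simp [hg]
  · simp [fderiv_zero_of_not_differentiableAt h]

/-- Partial derivatives commute with translations. -/
theorem pd_add_of_invariant {ι : Type} [Fintype ι] [DecidableEq ι] (j : ι)
    {g : (ι → ℝ) → ℝ} {v : ι → ℝ} (hg : ∀ w, g (w + v) = g w) (x : ι → ℝ) :
    pd j g (x + v) = pd j g x := by
  unfold pd
  rw [← fderiv_comp_add_right]
  simp only [hg]

theorem pd_const {ι : Type} [Fintype ι] [DecidableEq ι] (i : ι) (c : ℝ) (x : ι → ℝ) :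
    pd i (fun _ => c) x = 0 :=
  pd_eq_zero_of_invariant (fun _ _ => rfl) x

section PattersonWalker

variable {ι : Type} [Fintype ι] [DecidableEq ι] (Γ : ι → ι → ι → (ι → ℝ) → ℝ)

theorem pwGen_eq_fromBlocks (u : (ι ⊕ ι) → ℝ) :
    pwGen Γ u = Matrix.fromBlocks (pwGen Γ u).toBlocks₁₁ 1 1 0 := by
  ext (i | i) (j | j) <;> simp [pwGen, Matrix.toBlocks₁₁, Matrix.one_apply]

theorem pwGen_inv (u : (ι ⊕ ι) → ℝ) :
    (pwGen Γ u)⁻¹ = Matrix.fromBlocks 0 1 1 (-(pwGen Γ u).toBlocks₁₁) := by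
  apply Matrix.inv_eq_right_inv
  conv_lhs => rw [pwGen_eq_fromBlocks]
  simp [Matrix.fromBlocks_multiply]

/-- The horizontal Christoffel symbols of the Patterson–Walker metric. -/
theorem christoffel_pwGen_inl (k : ι) (i j : ι ⊕ ι) (u : (ι ⊕ ι) → ℝ) :
    christoffel (pwGen Γ) (Sum.inl k) i j u =
      -(1 / 2) * pd (Sum.inr k) (fun y => pwGen Γ y i j) u := by
  have hconst : ∀ (a b : ι ⊕ ι), pd a (fun y => pwGen Γ y b (Sum.inr k)) u = 0 := by
    rintro a (b | b) <;> exact pd_const _ _ _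
  simp [christoffel, pwGen_inv, Matrix.one_apply, hconst]

theorem christoffel_pwGen_inl_inr (k : ι) (i : ι ⊕ ι) (j : ι) (u : (ι ⊕ ι) → ℝ) :
    christoffel (pwGen Γ) (Sum.inl k) i (Sum.inr j) u = 0 := by
  rw [christoffel_pwGen_inl]
  rcases i with i | i <;> simp [pwGen, pd_const]

theorem christoffel_pwGen_inr_inl (k i j : ι) (u : (ι ⊕ ι) → ℝ) :
    christoffel (pwGen Γ) (Sum.inl k) (Sum.inr i) (Sum.inl j) u = 0 := by
  rw [christoffel_pwGen_inl]
  simp [pwGen, pd_const]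

theorem laplacian_pwGen_horizontal (f : (ι → ℝ) → ℝ) (u : (ι ⊕ ι) → ℝ) :
    laplacian (pwGen Γ) (fun w => f (fun A => w (Sum.inl A))) u = 0 := by
  set F : ((ι ⊕ ι) → ℝ) → ℝ := fun w => f (fun A => w (Sum.inl A)) with hF
  have hinv : ∀ (i : ι) w (t : ℝ), F (w + t • Pi.single (Sum.inr i) 1) = F w := by
    intro i w t
    simp [hF]
  have hvert : ∀ (i : ι) w, pd (Sum.inr i) F w = 0 := fun i w =>
    pd_eq_zero_of_invariant (hinv i) w
  have hmixed : ∀ (i : ι) j w, pd (Sum.inr i) (fun y => pd j F y) w = 0 := fun i j w =>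
    pd_eq_zero_of_invariant (fun y t => pd_add_of_invariant j (fun z => hinv i z t) y) w
  simp [laplacian, pwGen_inv, hvert, hmixed, pd_const, christoffel_pwGen_inl_inr,
    christoffel_pwGen_inr_inl]

end PattersonWalker

/-- The Laplacian of the Patterson–Walker metric annihilates
every horizontal function `F(x,p) = f(x)`. -/
theorem pw_metric_laplacian_horizontal
    (n : ℕ) (hn : 2 ≤ n) (Γ : Fin n → Fin n → Fin n → (Fin n → ℝ) → ℝ)
    (hsmooth : ∀ C A B, ContDiff ℝ (⊤ : ℕ∞) (Γ C A B))
    (hsym : ∀ C A B x, Γ C A B x = Γ C B A x) :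
    ∀ f : (Fin n → ℝ) → ℝ, ContDiff ℝ (⊤ : ℕ∞) f →
      ∀ u : (Fin n ⊕ Fin n) → ℝ,
        laplacian (pwGen Γ) (fun w => f (fun A => w (Sum.inl A))) u = 0 := by
  exact fun f _ u => laplacian_pwGen_horizontal Γ f u
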